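/- Let i ≥ 0 and let β ∈ 𝒜_{(2g,2i)} be a bihomogeneous element of bidegree (2g, 2i). Then F^{g+1}(x_{2,0}·β) = 0. In particular, every monomial of 𝒜 of bidegree (2g+2, 2i) that is divisible by x_{2,0} is annihilated by F^{g+1}. -/

import Mathlib

open MvPolynomial

/-- The index set `S_g` of pairs `(i,j)` of integers. -/
def Sg (g : ℕ) : Set (ℤ × ℤ) :=
  {p | 0 ≤ p.1 ∧ 0 ≤ p.2 ∧ p.2 ≤ 2 * (g : ℤ) - 2 ∧ p.1 ≤ p.2 + 2 ∧
    Even (p.1 + p.2) ∧ p ≠ (0, 0)}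

/-- The variables of the polynomial algebra `𝒜`: one variable `x_{i,j}` for each
`(i,j) ∈ S_g`, plus one extra variable `y`. -/
abbrev JacVar (g : ℕ) := {p : ℤ × ℤ // p ∈ Sg g} ⊕ Unit

/-- The polynomial algebra `𝒜` over `ℚ`. -/
abbrev JacA (g : ℕ) := MvPolynomial (JacVar g) ℚ

open Classical in
/-- The element `x_{i,j}` of `𝒜`, with the conventions `x_{0,0} = g` and `x_{i,j} = 0` for
`(i,j) ∉ S_g ∪ {(0,0)}`. -/
noncomputable def Xv (g : ℕ) (i j : ℤ) : JacA g :=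
  if h : (i, j) ∈ Sg g then X (Sum.inl ⟨(i, j), h⟩)
  else if (i, j) = ((0 : ℤ), (0 : ℤ)) then C (g : ℚ) else 0

/-- The element `y` of `𝒜`. -/
noncomputable def Yv (g : ℕ) : JacA g := X (Sum.inr ())

/-- The bigrading: `x_{i,j}` has bidegree `(i,j)` and `y` has bidegree `(0,2)`. -/
def wt (g : ℕ) : JacVar g → ℤ × ℤ
  | Sum.inl p => p.1
  | Sum.inr _ => (0, 2)

/-- The bihomogeneous component `𝒜_{(i,j)}`. -/
noncomputable def Acomp (g : ℕ) (i j : ℤ) : Submodule ℚ (JacA g) :=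
  weightedHomogeneousSubmodule ℚ (wt g) (i, j)

/-- Binomial coefficient `binom(n,r)` for integers, equal to `0` unless `0 ≤ r ≤ n`. -/
def ibinom (n r : ℤ) : ℚ :=
  if 0 ≤ r ∧ r ≤ n then (n.toNat.choose r.toNat : ℚ) else 0

open Classical in
/-- The (finite) set `S_g` as a `Finset` of pairs of integers. -/
noncomputable def SgFinset (g : ℕ) : Finset (ℤ × ℤ) :=
  ((Finset.Icc (0 : ℤ) (2 * (g : ℤ))) ×ˢ (Finset.Icc (0 : ℤ) (2 * (g : ℤ)))).filter
    (· ∈ Sg g)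

open Classical in
/-- Partial derivative `∂x_{i,j}` (zero if `(i,j) ∉ S_g`). -/
noncomputable def pd (g : ℕ) (p : ℤ × ℤ) (P : JacA g) : JacA g :=
  if h : p ∈ Sg g then pderiv (Sum.inl ⟨p, h⟩) P else 0

/-- The operator `E`: multiplication by `x_{2,0}`. -/
noncomputable def Eop (g : ℕ) (P : JacA g) : JacA g := Xv g 2 0 * P

/-- The differential operator `F`. -/
noncomputable def Fop (g : ℕ) (P : JacA g) : JacA g :=
  (1 / 2 : ℚ) • (∑ p ∈ SgFinset g, ∑ q ∈ SgFinset g,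
      (Yv g * Xv g (p.1 - 1) (p.2 - 1) * Xv g (q.1 - 1) (q.2 - 1)
        - C (ibinom (p.1 + q.1 - 2) (p.1 - 1)) * Xv g (p.1 + q.1 - 2) (p.2 + q.2))
      * pd g p (pd g q P))
  + ∑ p ∈ SgFinset g, Xv g (p.1 - 2) p.2 * pd g p P

lemma mem_SgFinset {g : ℕ} {p : ℤ × ℤ} : p ∈ SgFinset g ↔ p ∈ Sg g := by
  simp only [SgFinset, Finset.mem_filter, Finset.mem_product, Finset.mem_Icc, and_iff_right_iff_imp]
  rintro ⟨h₁, h₂, h₃, h₄, -⟩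
  omega

lemma two_zero_mem_Sg {g : ℕ} (hg : 1 ≤ g) : ((2, 0) : ℤ × ℤ) ∈ Sg g :=
  ⟨by norm_num, le_rfl, by simp; omega, by norm_num, by simp, by simp⟩

lemma Xv_of_mem {g : ℕ} {p : ℤ × ℤ} (hp : p ∈ Sg g) : Xv g p.1 p.2 = X (Sum.inl ⟨p, hp⟩) :=
  dif_pos hp

lemma Xv_zero_zero (g : ℕ) : Xv g 0 0 = C (g : ℚ) := by
  simp [Xv, Sg]

lemma Xv_of_snd_neg (g : ℕ) {i j : ℤ} (hj : j < 0) : Xv g i j = 0 := by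
  have h : (i, j) ∉ Sg g := fun h => absurd h.2.1 (not_le.mpr hj)
  simp [Xv, h, hj.ne]

lemma ibinom_one {n : ℤ} (hn : 0 ≤ n) : ibinom n 1 = n := by
  lift n to ℕ using hn
  rcases n with _ | n <;> simp [ibinom]

lemma ibinom_sub_one {n : ℤ} (hn : 0 ≤ n) : ibinom n (n - 1) = n := by
  lift n to ℕ using hn
  rcases n with _ | n <;> simp [ibinom]

lemma pd_add (g : ℕ) (p : ℤ × ℤ) (P Q : JacA g) : pd g p (P + Q) = pd g p P + pd g p Q := by
  unfold pd; split_ifs <;> simp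

lemma pd_mul (g : ℕ) (p : ℤ × ℤ) (P Q : JacA g) :
    pd g p (P * Q) = pd g p P * Q + P * pd g p Q := by
  unfold pd
  split_ifs
  · exact pderiv_mul
  · simp

lemma pd_smul (g : ℕ) (p : ℤ × ℤ) (c : ℚ) (P : JacA g) : pd g p (c • P) = c • pd g p P := by
  unfold pd; split_ifs <;> simp

lemma pd_zero (g : ℕ) (p : ℤ × ℤ) : pd g p 0 = 0 := by
  unfold pd; split_ifs <;> simp

lemma pd_Xv_mul {g : ℕ} {p q : ℤ × ℤ} (hq : q ∈ Sg g) (P : JacA g) :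
    pd g p (Xv g q.1 q.2 * P) = (if p = q then P else 0) + Xv g q.1 q.2 * pd g p P := by
  rw [pd_mul, Xv_of_mem hq]
  congr 1
  split_ifs with h
  · subst h; simp [pd, hq]
  · unfold pd
    split_ifs with hp
    · rw [pderiv_X_of_ne (by simpa [eq_comm] using h), zero_mul]
    · simp

lemma pd_pd_Xv_mul {g : ℕ} {p q r : ℤ × ℤ} (hr : r ∈ Sg g) (P : JacA g) :
    pd g p (pd g q (Xv g r.1 r.2 * P)) = (if q = r then pd g p P else 0) +
      ((if p = r then pd g q P else 0) + Xv g r.1 r.2 * pd g p (pd g q P)) := by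
  rw [pd_Xv_mul hr, pd_add, pd_Xv_mul hr]
  split_ifs <;> simp [pd_zero]

/-- The Euler operator of the first grading. -/
noncomputable def eulerOp (g : ℕ) (P : JacA g) : JacA g :=
  ∑ p ∈ SgFinset g, C (p.1 : ℚ) * Xv g p.1 p.2 * pd g p P

lemma Fop_add (g : ℕ) (P Q : JacA g) : Fop g (P + Q) = Fop g P + Fop g Q := by
  simp only [Fop, pd_add, mul_add, Finset.sum_add_distrib, smul_add]
  abel

lemma Fop_smul (g : ℕ) (c : ℚ) (P : JacA g) : Fop g (c • P) = c • Fop g P := by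
  simp only [Fop, pd_smul, mul_smul_comm, ← Finset.smul_sum, smul_add, smul_comm c (1 / 2 : ℚ)]

/-- The commutator of `F` with multiplication by `x_{2,0}`. -/
lemma Fop_Xv_mul {g : ℕ} (hg : 1 ≤ g) (P : JacA g) :
    Fop g (Xv g 2 0 * P) = Xv g 2 0 * Fop g P + (C (g : ℚ) * P - eulerOp g P) := by
  have h20 := two_zero_mem_Sg hg
  have hpd (p) := pd_Xv_mul (p := p) h20 P
  have hpdpd (p q) := pd_pd_Xv_mul (p := p) (q := q) h20 P
  simp only at hpd hpdpd
  have hleft (q) (hq : q ∈ SgFinset g) :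
      (Yv g * Xv g (2 - 1) (0 - 1) * Xv g (q.1 - 1) (q.2 - 1)
        - C (ibinom (2 + q.1 - 2) (2 - 1)) * Xv g (2 + q.1 - 2) (0 + q.2)) * pd g q P
        = -(C (q.1 : ℚ) * Xv g q.1 q.2 * pd g q P) := by
    rw [Xv_of_snd_neg g (by norm_num : (0 - 1 : ℤ) < 0), show 2 + q.1 - 2 = q.1 by ring,
      show (2 - 1 : ℤ) = 1 by norm_num, ibinom_one (mem_SgFinset.mp hq).1, zero_add]
    ring
  have hright (p) (hp : p ∈ SgFinset g) :
      (Yv g * Xv g (p.1 - 1) (p.2 - 1) * Xv g (2 - 1) (0 - 1)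
        - C (ibinom (p.1 + 2 - 2) (p.1 - 1)) * Xv g (p.1 + 2 - 2) (p.2 + 0)) * pd g p P
        = -(C (p.1 : ℚ) * Xv g p.1 p.2 * pd g p P) := by
    rw [Xv_of_snd_neg g (by norm_num : (0 - 1 : ℤ) < 0), show p.1 + 2 - 2 = p.1 by ring,
      ibinom_sub_one (mem_SgFinset.mp hp).1, add_zero]
    ring
  have hcomm (a b : JacA g) : a * (Xv g 2 0 * b) = Xv g 2 0 * (a * b) := mul_left_comm _ _ _
  simp only [Fop, hpdpd]
  simp only [hpd, mul_add, Finset.sum_add_distrib, mul_ite, mul_zero,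
    Finset.sum_ite_eq', mem_SgFinset.mpr h20, if_true, Finset.sum_ite_irrel,
    Finset.sum_const_zero, hcomm, ← Finset.mul_sum]
  rw [Finset.sum_congr rfl hleft, Finset.sum_congr rfl hright, sub_self, Xv_zero_zero,
    Finset.sum_neg_distrib, ← eulerOp, mul_smul_comm, smul_add, smul_add]
  module

/-- Euler's identity for the first grading. -/
lemma eulerOp_of_mem_Acomp {g : ℕ} {a b : ℤ} {P : JacA g} (hP : P ∈ Acomp g a b) :
    eulerOp g P = (a : ℚ) • P := by
  let instSg : Fintype {p : ℤ × ℤ // p ∈ Sg g} := Fintype.subtype (SgFinset g) fun _ => mem_SgFinset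
  have hmon (m : JacVar g →₀ ℕ) (c : ℚ) : eulerOp g (monomial m c) =
      ((Finsupp.weight (wt g) m).1 : ℚ) • monomial m c := by
    have hterm (p : {p : ℤ × ℤ // p ∈ Sg g}) :
        C (p.1.1 : ℚ) * Xv g p.1.1 p.1.2 * pd g p.1 (monomial m c)
          = ((p.1.1 * m (Sum.inl p) : ℤ) : ℚ) • monomial m c := by
      rw [Xv_of_mem p.2, pd, dif_pos p.2, mul_assoc, X_mul_pderiv_monomial, ← smul_eq_C_mul]
      push_cast
      rw [mul_smul, Nat.cast_smul_eq_nsmul]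
    rw [eulerOp, Finset.sum_subtype (F := instSg) _ (fun _ => mem_SgFinset)]
    simp only [hterm]
    rw [← Finset.sum_smul, Finsupp.weight_apply, Finsupp.sum_fintype _ _ (by simp)]
    congr 1
    simp [Prod.fst_sum, wt, mul_comm]
  have hadd (s : Finset (JacVar g →₀ ℕ)) (f : (JacVar g →₀ ℕ) → JacA g) :
      eulerOp g (∑ m ∈ s, f m) = ∑ m ∈ s, eulerOp g (f m) :=
    map_sum (⟨⟨eulerOp g, by simp [eulerOp, pd_zero]⟩,
      fun P Q => by simp [eulerOp, pd_add, mul_add, Finset.sum_add_distrib]⟩ : JacA g →+ JacA g) f s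
  rw [P.as_sum, hadd, Finset.smul_sum]
  refine Finset.sum_congr rfl fun m hm => ?_
  rw [hmon, hP (mem_support_iff.mp hm)]

lemma Xv_mem_Acomp (g : ℕ) (i j : ℤ) : Xv g i j ∈ Acomp g i j := by
  unfold Xv
  split_ifs with h h'
  · exact isWeightedHomogeneous_X ℚ (wt g) (Sum.inl ⟨(i, j), h⟩)
  · rw [Prod.mk.injEq] at h'
    obtain ⟨rfl, rfl⟩ := h'
    exact isWeightedHomogeneous_C (wt g) (g : ℚ)
  · exact zero_mem _

lemma Yv_mem_Acomp (g : ℕ) : Yv g ∈ Acomp g 0 2 := isWeightedHomogeneous_X ℚ (wt g) (Sum.inr ())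

lemma mul_mem_Acomp {g : ℕ} {a b c d i j : ℤ} {P Q : JacA g} (hP : P ∈ Acomp g a b)
    (hQ : Q ∈ Acomp g c d) (hi : a + c = i) (hj : b + d = j) : P * Q ∈ Acomp g i j := by
  subst hi hj
  exact IsWeightedHomogeneous.mul hP hQ

lemma pd_mem_Acomp {g : ℕ} {a b : ℤ} {P : JacA g} (hP : P ∈ Acomp g a b) (p : ℤ × ℤ) :
    pd g p P ∈ Acomp g (a - p.1) (b - p.2) := by
  unfold pd
  split_ifs with h
  · exact IsWeightedHomogeneous.pderiv hP (by ext <;> simp [wt])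
  · exact zero_mem _

lemma Fop_mem_Acomp {g : ℕ} {a b : ℤ} {P : JacA g} (hP : P ∈ Acomp g a b) :
    Fop g P ∈ Acomp g (a - 2) b := by
  refine add_mem (Submodule.smul_mem _ _ <| sum_mem fun p _ => sum_mem fun q _ => ?_)
    (sum_mem fun p _ => mul_mem_Acomp (Xv_mem_Acomp g _ _) (pd_mem_Acomp hP p) (by ring) (by ring))
  refine mul_mem_Acomp (a := p.1 + q.1 - 2) (b := p.2 + q.2) (sub_mem ?_ ?_)
    (pd_mem_Acomp (pd_mem_Acomp hP q) p) (by ring) (by ring)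
  · exact mul_mem_Acomp (mul_mem_Acomp (Yv_mem_Acomp g) (Xv_mem_Acomp g _ _) rfl rfl)
      (Xv_mem_Acomp g _ _) (by ring) (by ring)
  · exact IsWeightedHomogeneous.C_mul (Xv_mem_Acomp g _ _) _

lemma iterate_Fop_mem_Acomp {g : ℕ} {a b : ℤ} {P : JacA g} (hP : P ∈ Acomp g a b) (n : ℕ) :
    (Fop g)^[n] P ∈ Acomp g (a - 2 * n) b := by
  induction n with
  | zero => simpa using hP
  | succ n ih =>
    rw [Function.iterate_succ_apply']
    convert Fop_mem_Acomp ih using 1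
    push_cast
    ring_nf

lemma eq_zero_of_mem_Acomp_of_neg {g : ℕ} {a b : ℤ} (ha : a < 0) {P : JacA g}
    (hP : P ∈ Acomp g a b) : P = 0 := by
  refine IsWeightedHomogeneous.eq_zero_of_no_monomials hP fun m hm => ha.not_ge ?_
  rw [Finsupp.weight_apply, Finsupp.sum] at hm
  replace hm := congrArg Prod.fst hm
  rw [Prod.fst_sum] at hm
  change _ = a at hm
  rw [← hm]
  refine Finset.sum_nonneg fun v _ => ?_
  rcases v with p | _
  · exact nsmul_nonneg p.2.1 _
  · simp [wt]

/-- The `sl₂` relation between `F^n` and multiplication by `x_{2,0}`. -/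
lemma iterate_Fop_succ_Xv_mul {g : ℕ} (hg : 1 ≤ g) {a b : ℤ} {P : JacA g}
    (hP : P ∈ Acomp g a b) (n : ℕ) :
    (Fop g)^[n + 1] (Xv g 2 0 * P) = Xv g 2 0 * (Fop g)^[n + 1] P +
      ((n + 1 : ℚ) * (g - a + n)) • (Fop g)^[n] P := by
  have hone {c : ℤ} {Q : JacA g} (hQ : Q ∈ Acomp g c b) :
      Fop g (Xv g 2 0 * Q) = Xv g 2 0 * Fop g Q + ((g : ℚ) - c) • Q := by
    rw [Fop_Xv_mul hg, eulerOp_of_mem_Acomp hQ, ← smul_eq_C_mul, sub_smul]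
  induction n with
  | zero => simpa using hone hP
  | succ n ih =>
    rw [Function.iterate_succ_apply', ih, Fop_add, Fop_smul,
      hone (iterate_Fop_mem_Acomp hP (n + 1)), ← Function.iterate_succ_apply' (Fop g) n,
      ← Function.iterate_succ_apply' (Fop g) (n + 1), add_assoc, ← add_smul]
    congr 2
    push_cast
    ring

lemma iterate_Fop_Xv_mul_eq_zero {g : ℕ} (hg : 1 ≤ g) {b : ℤ} {P : JacA g}
    (hP : P ∈ Acomp g (2 * (g : ℤ)) b) : (Fop g)^[g + 1] (Xv g 2 0 * P) = 0 := by
  rw [iterate_Fop_succ_Xv_mul hg hP, eq_zero_of_mem_Acomp_of_neg _ (iterate_Fop_mem_Acomp hP (g + 1))]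
  · push_cast
    simp only [mul_zero, zero_add]
    ring_nf
    simp
  · push_cast; omega

/-- For `i ≥ 0` and `β ∈ 𝒜_{(2g,2i)}` one has `F^{g+1}(x_{2,0}·β) = 0`;
in particular every monomial of bidegree `(2g+2, 2i)` divisible by `x_{2,0}` is
annihilated by `F^{g+1}`. -/
theorem statement_2 (g : ℕ) (hg : 1 ≤ g) :
    (∀ i : ℤ, 0 ≤ i → ∀ β ∈ Acomp g (2 * (g : ℤ)) (2 * i),
      (Fop g)^[g + 1] (Xv g 2 0 * β) = 0) ∧
    (∀ i : ℤ, 0 ≤ i → ∀ m : JacVar g →₀ ℕ,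
      (monomial m (1 : ℚ)) ∈ Acomp g (2 * (g : ℤ) + 2) (2 * i) →
      Xv g 2 0 ∣ (monomial m (1 : ℚ)) →
      (Fop g)^[g + 1] (monomial m (1 : ℚ)) = 0) := by
  refine ⟨fun i _ β hβ => iterate_Fop_Xv_mul_eq_zero hg hβ, fun i _ m hm hdvd => ?_⟩
  have h20 := two_zero_mem_Sg hg
  have hX := Xv_of_mem h20
  simp only at hX
  set v : JacVar g := Sum.inl ⟨(2, 0), h20⟩
  rw [hX, X_dvd_monomial] at hdvd
  have hv : m v ≠ 0 := hdvd.resolve_left one_ne_zero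
  have hsplit : Finsupp.single v 1 + (m - Finsupp.single v 1) = m :=
    add_tsub_cancel_of_le (Finsupp.single_le_iff.mpr (Nat.one_le_iff_ne_zero.mpr hv))
  have hmul : monomial m (1 : ℚ) = Xv g 2 0 * monomial (m - Finsupp.single v 1) 1 := by
    rw [hX, X, monomial_mul, hsplit, one_mul]
  have hwt : Finsupp.weight (wt g) m = (2 * (g : ℤ) + 2, 2 * i) :=
    hm (by simp)
  rw [hmul]
  refine iterate_Fop_Xv_mul_eq_zero hg (b := 2 * i)
    (isWeightedHomogeneous_monomial (wt g) _ _ (add_left_cancel (a := wt g v) ?_))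
  rw [← hsplit, map_add, Finsupp.weight_single, one_smul] at hwt
  rw [hwt]
  ext <;> simp [v, wt, add_comm]
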